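/- Let R be the Laurent polynomial ring in two variables over F₂, let M be a p×q matrix over R, and let r be its generic rank, i.e., I_r(M) ≠ 0 and I_{r+1}(M) = 0, where I_j(M) is the ideal generated by all j×j minors of M. Suppose I_r(M) is a proper ideal of R. Then there exist positive integers n, m such that, writing π : R → R_{n,m} := R/(x^n − 1, y^m − 1) for the quotient map and M^{(n,m)} for the entrywise image of M, the R_{n,m}-submodule of (R_{n,m})^q generated by the componentwise images under π of the vectors u ∈ R^q with M u = 0 is a proper submodule of the kernel {v ∈ (R_{n,m})^q : M^{(n,m)} v = 0}. -/

import Mathlib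

open Matrix

noncomputable section

set_option synthInstance.maxHeartbeats 1000000
set_option maxHeartbeats 1000000

/-- `R = F₂[x^{±1}, y^{±1}]`, the Laurent polynomial ring in two variables over the field
with two elements, realized as the monoid algebra of the additive group `ℤ × ℤ` over `ZMod 2`. -/
abbrev LaurentF2 : Type := AddMonoidAlgebra (ZMod 2) (ℤ × ℤ)

/-- The antipode automorphism `bar`, induced by the group automorphism `(a,b) ↦ (-a,-b)`. -/
def barR : LaurentF2 ≃ₐ[ZMod 2] LaurentF2 :=
  AddMonoidAlgebra.domCongr (ZMod 2) (ZMod 2) (AddEquiv.neg (ℤ × ℤ))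

/-- The automorphism `σ`, induced by the group automorphism `(a,b) ↦ (b,a)`. -/
def sigR : LaurentF2 ≃ₐ[ZMod 2] LaurentF2 :=
  AddMonoidAlgebra.domCongr (ZMod 2) (ZMod 2) (AddEquiv.prodComm : ℤ × ℤ ≃+ ℤ × ℤ)

/-- The automorphism `ρ`, induced by the group automorphism `(a,b) ↦ (-b,-a)`. -/
def rhoR : LaurentF2 ≃ₐ[ZMod 2] LaurentF2 :=
  AddMonoidAlgebra.domCongr (ZMod 2) (ZMod 2)
    ((AddEquiv.prodComm : ℤ × ℤ ≃+ ℤ × ℤ).trans (AddEquiv.neg (ℤ × ℤ)))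

/-- The monomial `x`, of exponent `(1, 0)`. -/
def xGen : LaurentF2 := AddMonoidAlgebra.single ((1 : ℤ), (0 : ℤ)) 1

/-- The monomial `y`, of exponent `(0, 1)`. -/
def yGen : LaurentF2 := AddMonoidAlgebra.single ((0 : ℤ), (1 : ℤ)) 1

/-- The determinantal ideal `I_j(M)`: the ideal generated by the determinants of all `j × j`
submatrices of `M` (chosen via injective row and column index maps); `I₀(M) = R`. -/
def detIdeal {p q : ℕ} (M : Matrix (Fin p) (Fin q) LaurentF2) (j : ℕ) : Ideal LaurentF2 :=
  Ideal.span {d : LaurentF2 | ∃ (r : Fin j → Fin p) (c : Fin j → Fin q),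
    Function.Injective r ∧ Function.Injective c ∧ d = (M.submatrix r c).det}

/-- The ideal `(x^n - 1, y^m - 1)` encoding periodic boundary conditions on an `n × m` torus. -/
def torusIdeal (n m : ℕ) : Ideal LaurentF2 := Ideal.span {xGen ^ n - 1, yGen ^ m - 1}

/-- The quotient ring `R_{n,m} = R/(x^n - 1, y^m - 1)`. -/
abbrev RTorus (n m : ℕ) : Type := LaurentF2 ⧸ torusIdeal n m

/-- The quotient map `π : R → R_{n,m}`. -/
def torusQuot (n m : ℕ) : LaurentF2 →+* RTorus n m := Ideal.Quotient.mk _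

namespace Matrix

/-- A matrix over a field whose rank is at least `k` has `k` linearly independent rows. -/
theorem exists_linearIndependent_rows_of_le_rank {K m n : Type*} [Field K] [Fintype m] [Fintype n]
    (A : Matrix m n K) {k : ℕ} (hk : k ≤ A.rank) :
    ∃ f : Fin k → m, Function.Injective f ∧ LinearIndependent K (A.submatrix f id).row := by
  rw [A.rank_eq_finrank_span_row] at hk
  obtain ⟨v, hv, -, hli⟩ := Submodule.exists_fun_fin_finrank_span_eq K (Set.range A.row)
  choose g hg using hv
  have hli' : LinearIndependent K (A.submatrix (g ∘ Fin.castLE hk) id).row := by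
    have hrow : (A.submatrix (g ∘ Fin.castLE hk) id).row = v ∘ Fin.castLE hk :=
      funext fun i => hg (Fin.castLE hk i)
    rw [hrow]
    exact hli.comp _ (Fin.castLE_injective hk)
  refine ⟨g ∘ Fin.castLE hk, fun i j hij => hli'.injective ?_, hli'⟩
  funext l
  exact congrArg (fun a => A a l) hij

/-- A matrix over a field whose rank is at least `k` has a nonzero `k × k` minor. -/
theorem exists_minor_ne_zero_of_le_rank {K m n : Type*} [Field K] [Fintype m] [Fintype n]
    (A : Matrix m n K) {k : ℕ} (hk : k ≤ A.rank) :
    ∃ (f : Fin k → m) (g : Fin k → n), Function.Injective f ∧ Function.Injective g ∧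
      (A.submatrix f g).det ≠ 0 := by
  obtain ⟨f, hf, hfi⟩ := A.exists_linearIndependent_rows_of_le_rank hk
  have hrank : k ≤ (A.submatrix f id)ᵀ.rank := by
    rw [rank_transpose, hfi.rank_matrix, Fintype.card_fin]
  obtain ⟨g, hg, hgi⟩ := exists_linearIndependent_rows_of_le_rank _ hrank
  refine ⟨f, g, hf, hg, ?_⟩
  have hunit := linearIndependent_rows_iff_isUnit.1 hgi
  rw [isUnit_iff_isUnit_det, ← det_transpose] at hunit
  exact hunit.ne_zero

/-- A nonzero `k × k` minor forces rank at least `k` over any field containing the ring. -/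
theorem le_rank_map_of_minor_ne_zero {R L m n : Type*} [CommRing R] [Field L] [Fintype n]
    (φ : R →+* L) (hφ : Function.Injective φ) (A : Matrix m n R) {k : ℕ}
    (f : Fin k → m) (g : Fin k → n) (h : (A.submatrix f g).det ≠ 0) :
    k ≤ (A.map φ).rank := by
  have hdet : ((A.map φ).submatrix f g).det ≠ 0 := by
    rw [submatrix_map, ← RingHom.mapMatrix_apply, ← RingHom.map_det]
    exact (map_ne_zero_iff φ hφ).2 h
  calc k = ((A.map φ).submatrix f g).rank := by
        rw [rank_of_det_ne_zero hdet, Fintype.card_fin]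
    _ ≤ _ := rank_submatrix_le _ _ _

/-- If the kernel of the reduction of a matrix to a residue field is spanned by reductions of
kernel vectors, then reduction does not lower the rank. -/
theorem rank_map_le_rank_map_of_ker_le_span {R K L m n : Type*} [CommRing R] [Field K] [Field L]
    [Fintype m] [Fintype n] (φ : R →+* K) (ψ : R →+* L) (hψ : Function.Injective ψ)
    (A : Matrix m n R)
    (h : LinearMap.ker (A.map φ).mulVecLin ≤
      Submodule.span K ((fun u : n → R => φ ∘ u) '' {u | A *ᵥ u = 0})) :
    (A.map ψ).rank ≤ (A.map φ).rank := by
  set S := (fun u : n → R => φ ∘ u) '' {u | A *ᵥ u = 0}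
  obtain ⟨d, hd, v, hv, hli⟩ : ∃ d, Module.finrank K (Submodule.span K S) = d ∧
      ∃ v : Fin d → n → K, (∀ i, v i ∈ S) ∧ LinearIndependent K v := by
    obtain ⟨v, hv, -, hli⟩ := Submodule.exists_fun_fin_finrank_span_eq K S
    exact ⟨_, rfl, v, hv, hli⟩
  choose u hu huv using hv
  let U : Matrix (Fin d) n R := of u
  have hUrow : (U.map φ).row = v := funext huv
  have hUrank : d ≤ (U.map φ).rank := by
    rw [LinearIndependent.rank_matrix (hUrow ▸ hli), Fintype.card_fin]
  obtain ⟨f, g, -, -, hdet⟩ := exists_minor_ne_zero_of_le_rank _ hUrank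
  have hdetR : (U.submatrix f g).det ≠ 0 := by
    intro h0
    rw [submatrix_map, ← RingHom.mapMatrix_apply, ← RingHom.map_det, h0, map_zero] at hdet
    exact hdet rfl
  have hUL : d ≤ (U.map ψ)ᵀ.rank := by
    rw [rank_transpose]
    exact le_rank_map_of_minor_ne_zero ψ hψ U f g hdetR
  have hmul : A * Uᵀ = 0 := by
    ext i j
    exact congrFun (hu j) i
  have hmulL : A.map ψ * (U.map ψ)ᵀ = 0 := by
    rw [← transpose_map, ← Matrix.map_mul, hmul, Matrix.map_zero _ (map_zero ψ)]
  have hle := rank_add_rank_le_card_of_mul_eq_zero hmulL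
  have hker := Submodule.finrank_mono h
  have hrn := (A.map φ).mulVecLin.finrank_range_add_finrank_ker
  rw [Module.finrank_fintype_fun_eq_card] at hrn
  change (A.map φ).rank + _ = _ at hrn
  omega

end Matrix

/-- A finite family of elements killed by a ring homomorphism is annihilated by an
element of image `1`, provided every element is a fixed point of a proper power map. -/
theorem exists_map_eq_one_and_mul_eq_zero {S K ι : Type*} [CommRing S] [CommRing K] [Fintype ι]
    {n : ℕ} (hn : 0 < n) (hS : ∀ z : S, z ^ (n + 1) = z) (f : S →+* K) (c : ι → S)
    (hc : ∀ i, f (c i) = 0) :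
    ∃ e : S, f e = 1 ∧ ∀ i, e * c i = 0 := by
  classical
  refine ⟨∏ i, (1 - c i ^ n), ?_, fun i => ?_⟩
  · simp [map_prod, hc, hn.ne']
  · have h0 : (1 - c i ^ n) * c i = 0 := by
      rw [sub_mul, one_mul, ← pow_succ, hS, sub_self]
    rw [← Finset.prod_erase_mul _ _ (Finset.mem_univ i), mul_assoc, h0, mul_zero]

/-- If the kernel of a matrix over a ring with `z ^ (n + 1) = z` is spanned by reductions of kernel
vectors, then so is the kernel over any quotient of that ring. -/
theorem Matrix.ker_map_comp_le_span {R S K m n : Type*} [CommRing R] [CommRing S] [CommRing K]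
    [Fintype m] [Fintype n] {k : ℕ} (hk : 0 < k) (hS : ∀ z : S, z ^ (k + 1) = z)
    (π : R →+* S) (f : S →+* K) (hf : Function.Surjective f) (A : Matrix m n R)
    (h : LinearMap.ker (A.map π).mulVecLin ≤
      Submodule.span S ((fun u : n → R => π ∘ u) '' {u | A *ᵥ u = 0})) :
    LinearMap.ker (A.map (f.comp π)).mulVecLin ≤
      Submodule.span K ((fun u : n → R => f.comp π ∘ u) '' {u | A *ᵥ u = 0}) := by
  have hspan : ∀ w ∈ Submodule.span S ((fun u : n → R => π ∘ u) '' {u | A *ᵥ u = 0}),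
      f ∘ w ∈ Submodule.span K ((fun u : n → R => f.comp π ∘ u) '' {u | A *ᵥ u = 0}) := by
    intro w hw
    induction hw using Submodule.span_induction with
    | mem w hw =>
      obtain ⟨u, hu, rfl⟩ := hw
      exact Submodule.subset_span ⟨u, hu, rfl⟩
    | zero =>
      convert Submodule.zero_mem _ using 1
      funext i
      exact map_zero f
    | add w₁ w₂ _ _ h₁ h₂ =>
      convert Submodule.add_mem _ h₁ h₂ using 1
      funext i
      exact map_add f _ _
    | smul a w _ hw =>
      convert Submodule.smul_mem _ (f a) hw using 1
      funext i
      exact map_mul f _ _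
  intro v hv
  obtain ⟨s, rfl⟩ := hf.comp_left v
  have hc (i : m) : f ((A.map π *ᵥ s) i) = 0 := by
    rw [RingHom.map_mulVec, Matrix.map_map]
    exact congrFun (LinearMap.mem_ker.1 hv) i
  obtain ⟨e, he, hec⟩ := exists_map_eq_one_and_mul_eq_zero hk hS f _ hc
  have hes : e • s ∈ LinearMap.ker (A.map π).mulVecLin := by
    rw [LinearMap.mem_ker, map_smul]
    funext i
    exact hec i
  convert hspan _ (h hes) using 1
  funext i
  simp [he]

theorem zpow_mul_zpow_pow_eq_one {G : Type*} [CommGroup G] {a b : G} {n : ℕ} (ha : a ^ n = 1)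
    (hb : b ^ n = 1) (i j : ℤ) : (a ^ i * b ^ j) ^ n = 1 := by
  rw [mul_pow, ← zpow_natCast, ← zpow_natCast, zpow_comm, zpow_natCast, ha, zpow_comm,
    zpow_natCast, hb, _root_.one_zpow, _root_.one_zpow, one_mul]

/-- Every monomial is an `n`-th root of unity on the `n × n` torus. -/
theorem torusQuot_single_pow (n : ℕ) (z : ℤ × ℤ) :
    torusQuot n n (AddMonoidAlgebra.single z 1) ^ n = 1 := by
  let U : Multiplicative (ℤ × ℤ) →* (RTorus n n)ˣ :=
    ((torusQuot n n : LaurentF2 →* RTorus n n).comp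
      (AddMonoidAlgebra.of (ZMod 2) (ℤ × ℤ))).toHomUnits
  have hU (w : ℤ × ℤ) :
      (U (Multiplicative.ofAdd w) : RTorus n n) =
        torusQuot n n (AddMonoidAlgebra.single w 1) := rfl
  have hx : U (Multiplicative.ofAdd (1, 0)) ^ n = 1 := by
    rw [Units.ext_iff, Units.val_pow_eq_pow_val, hU, ← map_pow, Units.val_one,
      ← map_one (torusQuot n n)]
    exact Ideal.Quotient.eq.2 (Ideal.subset_span (Or.inl rfl))
  have hy : U (Multiplicative.ofAdd (0, 1)) ^ n = 1 := by
    rw [Units.ext_iff, Units.val_pow_eq_pow_val, hU, ← map_pow, Units.val_one,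
      ← map_one (torusQuot n n)]
    exact Ideal.Quotient.eq.2 (Ideal.subset_span (Or.inr rfl))
  have hz : Multiplicative.ofAdd z =
      Multiplicative.ofAdd ((1 : ℤ), (0 : ℤ)) ^ z.1 *
        Multiplicative.ofAdd ((0 : ℤ), (1 : ℤ)) ^ z.2 := by
    rw [← ofAdd_zsmul, ← ofAdd_zsmul, ← ofAdd_add]
    simp
  rw [← hU, ← Units.val_pow_eq_pow_val, hz, map_mul, map_zpow, map_zpow,
    zpow_mul_zpow_pow_eq_one hx hy, Units.val_one]

/-- On the square torus of side `2 ^ d - 1`, every element is fixed by the `2 ^ d`-power map. -/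
theorem RTorus.pow_two_pow_eq_self {n d : ℕ} (h : n + 1 = 2 ^ d) (z : RTorus n n) :
    z ^ 2 ^ d = z := by
  have hchar : CharP LaurentF2 2 :=
    charP_of_injective_algebraMap (algebraMap (ZMod 2) LaurentF2).injective 2
  obtain ⟨z, rfl⟩ := Ideal.Quotient.mk_surjective z
  change torusQuot n n z ^ 2 ^ d = torusQuot n n z
  induction z using AddMonoidAlgebra.induction_linear with
  | zero => simp
  | add f g hf hg =>
    rw [← map_pow, add_pow_char_pow, map_add, map_add, map_pow, map_pow, hf, hg]
  | single a b =>
    rcases (by decide : ∀ c : ZMod 2, c = 0 ∨ c = 1) b with rfl | rfl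
    · simp
    · rw [← h, pow_succ, torusQuot_single_pow, one_mul]

/-- A monomial maps to a root of unity in a finite field. -/
theorem map_single_pow_card_sub_one {K : Type*} [Field K] [Finite K] (φ : LaurentF2 →+* K)
    (z : ℤ × ℤ) : φ (AddMonoidAlgebra.single z 1) ^ (Nat.card K - 1) = 1 := by
  have := Fintype.ofFinite K
  rw [Nat.card_eq_fintype_card]
  refine FiniteField.pow_card_sub_one_eq_one _ fun h0 => one_ne_zero (α := K) ?_
  rw [← map_one φ, AddMonoidAlgebra.one_def, ← add_neg_cancel z, ← one_mul (1 : ZMod 2),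
    ← AddMonoidAlgebra.single_mul_single, map_mul, h0, zero_mul]

/-- Determinantal-ideal criterion, proper-ideal case: if `M` has generic rank `r`
(`I_r(M) ≠ 0`, `I_{r+1}(M) = 0`) and `I_r(M)` is a proper ideal, then on some finite torus the
submodule generated by reductions of infinite-plane kernel vectors is a proper submodule of
the kernel of the reduced matrix: additional nonlocal stabilizers appear. -/
theorem span_lt_kernel_of_detIdeal_proper
    (p q r : ℕ) (M : Matrix (Fin p) (Fin q) LaurentF2)
    (hr0 : detIdeal M r ≠ ⊥) (hr1 : detIdeal M (r + 1) = ⊥)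
    (hproper : detIdeal M r ≠ ⊤) :
    ∃ n m : ℕ, 0 < n ∧ 0 < m ∧
      Submodule.span (RTorus n m)
          {w : Fin q → RTorus n m |
            ∃ u : Fin q → LaurentF2, M.mulVec u = 0 ∧ w = fun i => torusQuot n m (u i)} <
        LinearMap.ker ((M.map (torusQuot n m)).mulVecLin) := by
  obtain ⟨P, hP, hIP⟩ := Ideal.exists_le_maximal _ hproper
  let _ : Field (LaurentF2 ⧸ P) := Ideal.Quotient.field P
  have hft : Algebra.FiniteType (ZMod 2) (LaurentF2 ⧸ P) := inferInstance
  have hfin : Module.Finite (ZMod 2) (LaurentF2 ⧸ P) :=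
    finite_of_finite_type_of_isJacobsonRing (ZMod 2) (LaurentF2 ⧸ P)
  have hK : Finite (LaurentF2 ⧸ P) := Module.finite_of_finite (ZMod 2)
  set d := Module.finrank (ZMod 2) (LaurentF2 ⧸ P)
  have hcard : Nat.card (LaurentF2 ⧸ P) = 2 ^ d := by
    rw [Module.natCard_eq_pow_finrank (K := ZMod 2), Nat.card_zmod]
  obtain ⟨n, hn⟩ : ∃ n, n + 1 = 2 ^ d := ⟨2 ^ d - 1, Nat.sub_add_cancel Nat.one_le_two_pow⟩
  have hn0 : 0 < n := by
    have := Finite.one_lt_card (α := LaurentF2 ⧸ P)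
    omega
  have hroot (z : ℤ × ℤ) : AddMonoidAlgebra.single z 1 ^ n - 1 ∈ P := by
    have h := map_single_pow_card_sub_one (Ideal.Quotient.mk P) z
    rw [hcard, ← hn, Nat.add_sub_cancel] at h
    exact Ideal.Quotient.eq.1 (by rw [map_pow, h, map_one])
  have hle : torusIdeal n n ≤ P := by
    rw [torusIdeal, Ideal.span_le]
    rintro _ (rfl | rfl)
    exacts [hroot _, hroot _]
  have himage : {w : Fin q → RTorus n n | ∃ u : Fin q → LaurentF2, M.mulVec u = 0 ∧
      w = fun i => torusQuot n n (u i)} =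
      (fun u : Fin q → LaurentF2 => torusQuot n n ∘ u) '' {u | M *ᵥ u = 0} := by
    ext w
    exact exists_congr fun u => and_congr_right fun _ => eq_comm
  refine ⟨n, n, hn0, hn0, ?_⟩
  rw [himage, lt_iff_le_not_ge]
  constructor
  · rw [Submodule.span_le]
    rintro _ ⟨u, hu, rfl⟩
    rw [SetLike.mem_coe, LinearMap.mem_ker]
    funext i
    rw [mulVecLin_apply, ← RingHom.map_mulVec, hu]
    exact map_zero _
  · intro hker
    have hkerK := Matrix.ker_map_comp_le_span hn0
      (fun z => (congrArg (z ^ ·) hn).trans (RTorus.pow_two_pow_eq_self hn z))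
      (torusQuot n n) (Ideal.Quotient.factor hle) (Ideal.Quotient.factor_surjective hle) M hker
    have hrank := Matrix.rank_map_le_rank_map_of_ker_le_span _
      (algebraMap LaurentF2 (FractionRing LaurentF2)) (IsFractionRing.injective _ _) M hkerK
    have hr : r ≤ (M.map (algebraMap LaurentF2 (FractionRing LaurentF2))).rank := by
      by_contra hlt
      refine hr0 (Ideal.span_eq_bot.2 ?_)
      rintro _ ⟨f, g, -, -, rfl⟩
      by_contra hdet
      exact hlt (le_rank_map_of_minor_ne_zero _ (IsFractionRing.injective _ _) M f g hdet)
    obtain ⟨f, g, hf, hg, hdet⟩ := exists_minor_ne_zero_of_le_rank _ (hr.trans hrank)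
    rw [submatrix_map, ← RingHom.mapMatrix_apply, ← RingHom.map_det] at hdet
    exact hdet (Ideal.Quotient.eq_zero_iff_mem.2
      (hIP (Ideal.subset_span ⟨f, g, hf, hg, rfl⟩)))
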